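/- arXiv:math/0406247 — 3 statements merged into one kernel-verified Lean document; each statement's English description precedes it below -/
import Mathlib

section
/- Let G ≤ GL(4,ℝ) be the subgroup of block matrices of the form (γ u; 0 1) with γ ∈ SO(2,1)⁰ and u ∈ ℝ³ (the group of time-orientation- and orientation-preserving affine Lorentzian isometries x ↦ γx + u of ℝ³). Let A ≤ G be the one-parameter subgroup of elements with u = 0 and γ = a(t), where a(t) is the matrix with rows (cosh t, 0, sinh t), (0, 1, 0), (sinh t, 0, cosh t). Let Γ ≤ G be a subgroup such that the image Γ₀ of Γ under the projection (γ u; 0 1) ↦ γ is a discrete subgroup of SO(2,1)⁰ and this projection restricts to an isomorphism Γ → Γ₀ (an affine deformation of Γ₀). Then the affine action of Γ on ℝ³ (by x ↦ γx + u) is properly discontinuous if and only if the ℝ-action on the quotient space Γ\G defined by right multiplication by a(t) is proper. -/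
open Matrix

noncomputable section

/-- The Lorentzian bilinear form on `ℝ³`: `B(v,w) = v₁w₁ + v₂w₂ − v₃w₃`. -/
def Bform (v w : Fin 3 → ℝ) : ℝ := v 0 * w 0 + v 1 * w 1 - v 2 * w 2

/-- `SO(2,1)⁰`: linear automorphisms of `ℝ³` preserving `B`, with determinant 1,
preserving the future cone `{v | B(v,v) < 0, v₃ > 0}`. -/
def SO21 (γ : Matrix (Fin 3) (Fin 3) ℝ) : Prop :=
  (∀ v w : Fin 3 → ℝ, Bform (γ.mulVec v) (γ.mulVec w) = Bform v w) ∧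
  γ.det = 1 ∧
  (∀ v : Fin 3 → ℝ, Bform v v < 0 → 0 < v 2 → 0 < γ.mulVec v 2)

/-- The one-parameter subgroup `a(t)` of `SO(2,1)⁰` with rows
`(cosh t, 0, sinh t), (0, 1, 0), (sinh t, 0, cosh t)`. -/
def aMat (t : ℝ) : Matrix (Fin 3) (Fin 3) ℝ :=
  Matrix.of ![![Real.cosh t, 0, Real.sinh t], ![0, 1, 0], ![Real.sinh t, 0, Real.cosh t]]

/-- The block matrix `(γ u; 0 1) ∈ GL(4,ℝ)`. -/
def blockAff (γ : Matrix (Fin 3) (Fin 3) ℝ) (u : Fin 3 → ℝ) : Matrix (Fin 4) (Fin 4) ℝ :=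
  Matrix.of fun i j =>
    if hi : (i : ℕ) < 3 then
      (if hj : (j : ℕ) < 3 then γ ⟨i, hi⟩ ⟨j, hj⟩ else u ⟨i, hi⟩)
    else (if (j : ℕ) < 3 then 0 else 1)

/-- The linear part (upper-left `3 × 3` block) of a `4 × 4` matrix. -/
def linPart (g : Matrix (Fin 4) (Fin 4) ℝ) : Matrix (Fin 3) (Fin 3) ℝ :=
  Matrix.of fun i j => g (Fin.castSucc i) (Fin.castSucc j)

/-- The translational part (upper-right `3 × 1` block) of a `4 × 4` matrix. -/
def transPart (g : Matrix (Fin 4) (Fin 4) ℝ) : Fin 3 → ℝ :=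
  fun i => g (Fin.castSucc i) 3

/-- A map is proper in the sense that the preimage of every compact set is compact. -/
def CompactPreimages {α β : Type*} [TopologicalSpace α] [TopologicalSpace β]
    (f : α → β) : Prop :=
  ∀ K : Set β, IsCompact K → IsCompact (f ⁻¹' K)

/-- Right multiplication by `h` on the space `Γ\G` of right cosets. -/
def rightMulQuot {G : Type*} [Group G] (Γ : Subgroup G) (h : G) :
    Quotient (QuotientGroup.rightRel Γ) → Quotient (QuotientGroup.rightRel Γ) :=
  Quotient.map' (fun g => g * h) (by
    intro a b hab
    rw [QuotientGroup.rightRel_apply] at *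
    simpa [mul_assoc] using hab)


lemma blockAff_mul (γ δ : Matrix (Fin 3) (Fin 3) ℝ) (u v : Fin 3 → ℝ) :
    blockAff γ u * blockAff δ v = blockAff (γ * δ) (γ.mulVec v + u) := by
  ext i j
  fin_cases i <;> fin_cases j <;>
    simp [blockAff, Matrix.mul_apply, Fin.sum_univ_four, Fin.sum_univ_three, Matrix.mulVec, dotProduct]

lemma blockAff_one : blockAff 1 0 = 1 := by
  ext i j
  fin_cases i <;> fin_cases j <;> simp [blockAff, Matrix.one_apply]

lemma linPart_blockAff (γ : Matrix (Fin 3) (Fin 3) ℝ) (u : Fin 3 → ℝ) :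
    linPart (blockAff γ u) = γ := by
  ext i j
  fin_cases i <;> fin_cases j <;> simp [blockAff, linPart]

lemma transPart_blockAff (γ : Matrix (Fin 3) (Fin 3) ℝ) (u : Fin 3 → ℝ) :
    transPart (blockAff γ u) = u := by
  ext i
  fin_cases i <;> simp [blockAff, transPart]

def rotM (θ : ℝ) : Matrix (Fin 3) (Fin 3) ℝ :=
  Matrix.of ![![Real.cos θ, -Real.sin θ, 0], ![Real.sin θ, Real.cos θ, 0], ![0, 0, 1]]

lemma SO21_rot (θ : ℝ) : SO21 (rotM θ) := by
  refine ⟨fun v w => ?_, ?_, fun v _ h => ?_⟩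
  · simp [Bform, rotM, Matrix.mulVec, dotProduct, Fin.sum_univ_three]
    linear_combination (v 0 * w 0 + v 1 * w 1) * Real.sin_sq_add_cos_sq θ
  · simp [rotM, Matrix.det_fin_three]
    linear_combination Real.sin_sq_add_cos_sq θ
  · simpa [rotM, Matrix.mulVec, dotProduct, Fin.sum_univ_three] using h

lemma SO21_one : SO21 1 := by
  refine ⟨fun v w => by simp, by simp, fun v _ h => by simpa using h⟩

lemma exists_unit (γ : Matrix (Fin 3) (Fin 3) ℝ) (u : Fin 3 → ℝ) (h : SO21 γ) :
    ∃ g : (Matrix (Fin 4) (Fin 4) ℝ)ˣ, (g : Matrix (Fin 4) (Fin 4) ℝ) = blockAff γ u := by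
  have hd : IsUnit γ.det := by rw [h.2.1]; exact isUnit_one
  refine ⟨⟨blockAff γ u, blockAff γ⁻¹ (-(γ⁻¹.mulVec u)), ?_, ?_⟩, rfl⟩
  · rw [blockAff_mul, Matrix.mul_nonsing_inv _ hd, ← blockAff_one]
    congr 1
    rw [Matrix.mulVec_neg, Matrix.mulVec_mulVec, Matrix.mul_nonsing_inv _ hd]; simp
  · rw [blockAff_mul, Matrix.nonsing_inv_mul _ hd, ← blockAff_one]
    congr 1
    simp

lemma units_emb : Topology.IsOpenEmbedding
    (Units.val : (Matrix (Fin 4) (Fin 4) ℝ)ˣ → Matrix (Fin 4) (Fin 4) ℝ) := by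
  let _ : NormedRing (Matrix (Fin 4) (Fin 4) ℝ) := Matrix.linftyOpNormedRing
  have : @CompleteSpace (Matrix (Fin 4) (Fin 4) ℝ) PseudoMetricSpace.toUniformSpace :=
    inferInstanceAs (CompleteSpace (Fin 4 → Fin 4 → ℝ))
  exact Units.isOpenEmbedding_val

/-- SO21 with a closed condition -/
lemma SO21_iff (γ : Matrix (Fin 3) (Fin 3) ℝ) : SO21 γ ↔
    (∀ v w : Fin 3 → ℝ, Bform (γ.mulVec v) (γ.mulVec w) = Bform v w) ∧
  γ.det = 1 ∧
  (∀ v : Fin 3 → ℝ, Bform v v < 0 → 0 < v 2 → 0 ≤ γ.mulVec v 2) := by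
  constructor
  · rintro ⟨a, b, c⟩
    exact ⟨a, b, fun v h h' => (c v h h').le⟩
  · rintro ⟨a, b, c⟩
    refine ⟨a, b, fun v h h' => lt_of_le_of_ne (c v h h') ?_⟩
    intro h0
    have := a v v
    rw [← this] at h
    unfold Bform at h
    rw [← h0] at h
    nlinarith [sq_nonneg (γ.mulVec v 0), sq_nonneg (γ.mulVec v 1)]

lemma isClosed_SO21 : IsClosed {γ : Matrix (Fin 3) (Fin 3) ℝ | SO21 γ} := by
  simp only [SO21_iff, Set.ofPred_and, Set.ofPred_forall]
  refine IsClosed.inter ?_ (IsClosed.inter ?_ ?_)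
  · refine isClosed_iInter fun v => isClosed_iInter fun w => isClosed_eq ?_ continuous_const
    unfold Bform
    simp only [Matrix.mulVec, dotProduct]
    fun_prop
  · exact isClosed_eq (by fun_prop) continuous_const
  · refine isClosed_iInter fun v => isClosed_iInter fun _ => isClosed_iInter fun _ =>
      isClosed_le continuous_const ?_
    simp only [Matrix.mulVec, dotProduct]
    fun_prop

lemma continuous_linPart : Continuous linPart := by
  unfold linPart; fun_prop

lemma continuous_transPart : Continuous transPart := by
  unfold transPart; fun_prop

lemma continuous_blockAff {X : Type*} [TopologicalSpace X] (f : X → Matrix (Fin 3) (Fin 3) ℝ)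
    (g : X → Fin 3 → ℝ) (hf : Continuous f) (hg : Continuous g) :
    Continuous fun x => blockAff (f x) (g x) := by
  refine continuous_matrix fun i j => ?_
  fin_cases i <;> fin_cases j <;> simp [blockAff] <;> fun_prop

lemma isClosed_aff : IsClosed {m : Matrix (Fin 4) (Fin 4) ℝ | ∃ γ u, SO21 γ ∧ m = blockAff γ u} := by
  have : {m : Matrix (Fin 4) (Fin 4) ℝ | ∃ γ u, SO21 γ ∧ m = blockAff γ u} =
    {m | SO21 (linPart m)} ∩ {m | m = blockAff (linPart m) (transPart m)} := by
    ext m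
    constructor
    · rintro ⟨γ, u, h, rfl⟩
      simp [linPart_blockAff, transPart_blockAff, h]
    · rintro ⟨h, h'⟩
      exact ⟨_, _, h, h'⟩
  rw [this]
  refine (isClosed_SO21.preimage continuous_linPart).inter (isClosed_eq continuous_id ?_)
  exact continuous_blockAff _ _ continuous_linPart continuous_transPart

def actM (g : Matrix (Fin 4) (Fin 4) ℝ) (x : Fin 3 → ℝ) : Fin 3 → ℝ :=
  (linPart g).mulVec x + transPart g

lemma arg_polar (x y : ℝ) : ∃ θ ∈ Set.Icc (-Real.pi) Real.pi,
    x = √(x^2+y^2) * Real.cos θ ∧ y = √(x^2+y^2) * Real.sin θ := by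
  have h1 := Complex.norm_mul_cos_arg ⟨x, y⟩
  have h2 := Complex.norm_mul_sin_arg ⟨x, y⟩
  have h3 : ‖(⟨x, y⟩ : ℂ)‖ = √(x^2+y^2) := by
    rw [Complex.norm_def, Complex.normSq_mk]; congr 1; ring
  rw [h3] at h1 h2
  exact ⟨_, ⟨(Complex.neg_pi_lt_arg _).le, Complex.arg_le_pi _⟩, h1.symm, h2.symm⟩

def e3 : Fin 3 → ℝ := ![0, 0, 1]

lemma stab_rot (M : Matrix (Fin 3) (Fin 3) ℝ) (hM : SO21 M) (h : M.mulVec e3 = e3) :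
    ∃ θ ∈ Set.Icc (-Real.pi) Real.pi, M = rotM θ := by
  have h0 := congrFun h 0
  have h1 := congrFun h 1
  have h2 := congrFun h 2
  obtain ⟨hB, hd, -⟩ := hM
  have b02 := hB ![1,0,0] e3
  have b12 := hB ![0,1,0] e3
  have b00 := hB ![1,0,0] ![1,0,0]
  have b11 := hB ![0,1,0] ![0,1,0]
  have b01 := hB ![1,0,0] ![0,1,0]
  simp [e3, Bform, Matrix.mulVec, dotProduct, Fin.sum_univ_three] at h0 h1 h2 b02 b12 b00 b11 b01
  rw [Matrix.det_fin_three] at hd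
  rw [h0, h1, h2] at b02 b12
  simp at b02 b12
  rw [h0, h1, h2, b02, b12] at hd
  rw [b02] at b00 b01
  rw [b12] at b11 b01
  simp at hd b00 b01 b11
  have k1 : M 1 1 = M 0 0 := by
    linear_combination (-M 1 1) * b00 + M 0 0 * hd + M 1 0 * b01
  have k2 : M 0 1 = - M 1 0 := by
    linear_combination (-M 0 1) * b00 + M 0 0 * b01 - M 1 0 * hd
  obtain ⟨θ, hθ, c, s⟩ := arg_polar (M 0 0) (M 1 0)
  have : M 0 0 ^ 2 + M 1 0 ^ 2 = 1 := by linarith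
  rw [this] at c s
  simp at c s
  refine ⟨θ, hθ, ?_⟩
  ext i j
  fin_cases i <;> fin_cases j <;> simp [rotM, h0, h1, h2, b02, b12, k1, k2, c.symm, s.symm]

lemma cartan_pt (M : Matrix (Fin 3) (Fin 3) ℝ) (hM : SO21 M) :
    ∃ θ ∈ Set.Icc (-Real.pi) Real.pi, ∃ t : ℝ,
      M.mulVec e3 = (rotM θ).mulVec ((aMat t).mulVec e3) := by
  obtain ⟨hB, hd, hp⟩ := hM
  have b := hB e3 e3
  have p := hp e3 (by simp [Bform, e3]) (by simp [e3])
  simp [e3, Bform, Matrix.mulVec, dotProduct, Fin.sum_univ_three] at b p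
  obtain ⟨θ, hθ, c, s⟩ := arg_polar (M 0 2) (M 1 2)
  refine ⟨θ, hθ, Real.arsinh √(M 0 2 ^ 2 + M 1 2 ^ 2), ?_⟩
  have hc : Real.cosh (Real.arsinh √(M 0 2 ^ 2 + M 1 2 ^ 2)) = M 2 2 := by
    rw [Real.cosh_arsinh, Real.sq_sqrt (by positivity)]
    rw [show 1 + (M 0 2 ^ 2 + M 1 2 ^ 2) = M 2 2 ^ 2 by linarith]
    exact Real.sqrt_sq p.le
  ext i
  fin_cases i <;> simp [e3, Matrix.mulVec, dotProduct, Fin.sum_univ_three, rotM, aMat, hc]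
  · linarith
  · linarith

lemma lift_compact {G Q : Type*} [TopologicalSpace G] [TopologicalSpace Q] [LocallyCompactSpace G]
    (q : G → Q) (hq : IsOpenQuotientMap q) (K : Set Q) (hK : IsCompact K) :
    ∃ C : Set G, IsCompact C ∧ K ⊆ q '' C := by
  have hs := hq.surjective
  choose C hC hCn using fun g : G => exists_compact_mem_nhds g
  obtain ⟨t, -, ht⟩ := hK.elim_nhds_subcover (fun x => q '' C (Function.surjInv hs x)) (fun x _ => by
    have := hq.isOpenMap.image_mem_nhds (hCn (Function.surjInv hs x))
    rwa [Function.surjInv_eq hs] at this)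
  refine ⟨⋃ x ∈ t, C (Function.surjInv hs x), t.isCompact_biUnion fun x _ => hC _, ?_⟩
  rw [Set.image_iUnion₂]
  exact ht

lemma actM_blockAff (γ : Matrix (Fin 3) (Fin 3) ℝ) (u x : Fin 3 → ℝ) :
    actM (blockAff γ u) x = γ.mulVec x + u := by
  rw [actM, linPart_blockAff, transPart_blockAff]

theorem stmt_3
    (G : Subgroup (Matrix (Fin 4) (Fin 4) ℝ)ˣ)
    (hG : ∀ g : (Matrix (Fin 4) (Fin 4) ℝ)ˣ,
      g ∈ G ↔ ∃ γ u, SO21 γ ∧ (g : Matrix (Fin 4) (Fin 4) ℝ) = blockAff γ u)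
    (Γ : Subgroup (Matrix (Fin 4) (Fin 4) ℝ)ˣ) (hΓG : Γ ≤ G)
    (hdisc : DiscreteTopology
      {m : Matrix (Fin 3) (Fin 3) ℝ //
        ∃ g ∈ Γ, m = linPart ((g : (Matrix (Fin 4) (Fin 4) ℝ)ˣ) : Matrix (Fin 4) (Fin 4) ℝ)})
    (hinj : ∀ g h : (Matrix (Fin 4) (Fin 4) ℝ)ˣ, g ∈ Γ → h ∈ Γ →
      linPart (g : Matrix (Fin 4) (Fin 4) ℝ) = linPart (h : Matrix (Fin 4) (Fin 4) ℝ) →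
      g = h)
    (aG : ℝ → G)
    (haG : ∀ t : ℝ,
      ((aG t : (Matrix (Fin 4) (Fin 4) ℝ)ˣ) : Matrix (Fin 4) (Fin 4) ℝ) = blockAff (aMat t) 0) :
    (∀ K : Set (Fin 3 → ℝ), IsCompact K →
      {g : Γ | ∃ x ∈ K,
        (linPart ((g : (Matrix (Fin 4) (Fin 4) ℝ)ˣ) : Matrix (Fin 4) (Fin 4) ℝ)).mulVec x +
          transPart ((g : (Matrix (Fin 4) (Fin 4) ℝ)ˣ) : Matrix (Fin 4) (Fin 4) ℝ) ∈ K}.Finite)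
    ↔ CompactPreimages
        (fun p : ℝ × Quotient (QuotientGroup.rightRel (Γ.subgroupOf G)) =>
          (rightMulQuot (Γ.subgroupOf G) (aG p.1) p.2, p.2)) := by
  -- topology of `G`
  let val : G → Matrix (Fin 4) (Fin 4) ℝ := fun g => ((g : (Matrix (Fin 4) (Fin 4) ℝ)ˣ) : _)
  have hval : Topology.IsEmbedding val := units_emb.isEmbedding.comp Topology.IsEmbedding.subtypeVal
  have hvalc : Continuous val := hval.continuous
  have hGclosed : IsClosed (G : Set (Matrix (Fin 4) (Fin 4) ℝ)ˣ) := by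
    have : (G : Set (Matrix (Fin 4) (Fin 4) ℝ)ˣ) = Units.val ⁻¹'
        {m : Matrix (Fin 4) (Fin 4) ℝ | ∃ γ u, SO21 γ ∧ m = blockAff γ u} := by
      ext g; exact hG g
    rw [this]
    exact isClosed_aff.preimage units_emb.continuous
  have : LocallyCompactSpace (Matrix (Fin 4) (Fin 4) ℝ) :=
    inferInstanceAs (LocallyCompactSpace (Fin 4 → Fin 4 → ℝ))
  have : LocallyCompactSpace (Matrix (Fin 4) (Fin 4) ℝ)ˣ := units_emb.locallyCompactSpace
  have : LocallyCompactSpace G := hGclosed.isClosedEmbedding_subtypeVal.locallyCompactSpace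
  have : T2Space G := hval.t2Space
  have hGr : ∀ g : G, ∃ γ u, SO21 γ ∧ val g = blockAff γ u := fun g => (hG g).1 g.2
  -- the action
  have hvmul : ∀ g h : G, val (g * h) = val g * val h := fun g h => rfl
  have hact : ∀ (g h : G) x, actM (val (g * h)) x = actM (val g) (actM (val h) x) := by
    intro g h x
    obtain ⟨γ, u, -, hg⟩ := hGr g
    obtain ⟨δ, v, -, hh⟩ := hGr h
    rw [hvmul, hg, hh, blockAff_mul]
    simp only [actM_blockAff, ← Matrix.mulVec_mulVec, Matrix.mulVec_add, add_assoc]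
  have hact1 : ∀ x, actM (val 1) x = x := by
    intro x
    change actM 1 x = x
    rw [← blockAff_one, actM_blockAff]; simp
  have hactinv : ∀ (g : G) x, actM (val g⁻¹) (actM (val g) x) = x := by
    intro g x; rw [← hact, inv_mul_cancel, hact1]
  have hmk : ∀ γ u, SO21 γ → ∃ g : G, val g = blockAff γ u := by
    intro γ u h
    obtain ⟨g, hg⟩ := exists_unit γ u h
    exact ⟨⟨g, (hG g).2 ⟨γ, u, h, hg⟩⟩, hg⟩
  choose rG hrG using fun θ => hmk (rotM θ) 0 (SO21_rot θ)
  choose τ hτ using fun x => hmk 1 x SO21_one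
  have haG' : ∀ t, val (aG t) = blockAff (aMat t) 0 := haG
  have hrc : Continuous rG := by
    rw [hval.continuous_iff]
    have : val ∘ rG = fun θ => blockAff (rotM θ) 0 := funext hrG
    rw [this]
    refine continuous_blockAff _ _ ?_ continuous_const
    refine continuous_matrix fun i j => ?_
    fin_cases i <;> fin_cases j <;> simp [rotM] <;> fun_prop
  have hac : Continuous aG := by
    rw [hval.continuous_iff]
    have : val ∘ aG = fun θ => blockAff (aMat θ) 0 := funext haG
    rw [this]
    refine continuous_blockAff _ _ ?_ continuous_const
    refine continuous_matrix fun i j => ?_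
    fin_cases i <;> fin_cases j <;> simp [aMat] <;> fun_prop
  have hτc : Continuous τ := by
    rw [hval.continuous_iff]
    have : val ∘ τ = fun x => blockAff 1 x := funext hτ
    rw [this]
    exact continuous_blockAff _ _ continuous_const continuous_id
  -- `Γ'` is discrete
  set Γ' := Γ.subgroupOf G with hΓ'
  have hD : DiscreteTopology Γ' := by
    let φ : Γ' → {m : Matrix (Fin 3) (Fin 3) ℝ //
        ∃ g ∈ Γ, m = linPart ((g : (Matrix (Fin 4) (Fin 4) ℝ)ˣ) : Matrix (Fin 4) (Fin 4) ℝ)} :=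
      fun g => ⟨linPart (val g), ((g : G) : (Matrix (Fin 4) (Fin 4) ℝ)ˣ), g.2, rfl⟩
    refine DiscreteTopology.of_continuous_injective (f := φ) ?_ ?_
    · exact (continuous_linPart.comp (hvalc.comp continuous_subtype_val)).subtype_mk _
    · intro g h hgh
      have := hinj _ _ g.2 h.2 (congrArg Subtype.val hgh)
      exact Subtype.ext (Subtype.ext this)
  have hcof := Γ'.tendsto_coe_cofinite_of_discrete ⟨hD⟩
  have hfin : ∀ S : Set G, IsCompact S → {γ : Γ' | (γ : G) ∈ S}.Finite := by
    intro S hS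
    have := hcof hS.compl_mem_cocompact
    simp only [Filter.mem_map, Filter.mem_cofinite, Set.preimage_compl, compl_compl] at this
    exact this
  have : ProperlyDiscontinuousSMul Γ' G := Γ'.properlyDiscontinuousSMul_of_tendsto_cofinite hcof
  let q : G → Quotient (QuotientGroup.rightRel Γ') := Quotient.mk _
  have hq : IsOpenQuotientMap q := MulAction.isOpenQuotientMap_quotientMk (Γ := Γ') (T := G)
  have hT2 : T2Space (Quotient (QuotientGroup.rightRel Γ')) :=
    t2Space_of_properlyDiscontinuousSMul_of_t2Space (Γ := Γ') (T := G)
  have hqeq : ∀ g h : G, q g = q h ↔ h * g⁻¹ ∈ Γ' := by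
    intro g h
    rw [← QuotientGroup.rightRel_apply]
    exact Quotient.eq
  have hrm : ∀ g h : G, rightMulQuot Γ' h (q g) = q (g * h) := fun g h => rfl
  constructor
  · intro hpd K hK
    have hcont : Continuous (fun p : ℝ × Quotient (QuotientGroup.rightRel Γ') =>
          (rightMulQuot Γ' (aG p.1) p.2, p.2)) := by
      refine Continuous.prodMk ?_ continuous_snd
      have hQ := (IsOpenQuotientMap.id (X := ℝ)).prodMap hq
      rw [hQ.isQuotientMap.continuous_iff]
      exact hq.continuous.comp (continuous_snd.mul (hac.comp continuous_fst))
    have hcl := hK.isClosed.preimage hcont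
    obtain ⟨C1, hC1, hK1⟩ := lift_compact q hq _ (hK.image continuous_fst)
    obtain ⟨C2, hC2, hK2⟩ := lift_compact q hq _ (hK.image continuous_snd)
    let o : G → Fin 3 → ℝ := fun g => actM (val g) 0
    have ho : Continuous o := by
      have : o = fun g => transPart (val g) := by
        funext g; simp [o, actM]
      rw [this]; exact continuous_transPart.comp hvalc
    have hoa : ∀ g t, o (g * aG t) = o g := by
      intro g t
      simp only [o, hact, haG', actM_blockAff]; simp
    have hF := hpd (o '' C1 ∪ o '' C2) ((hC1.image ho).union (hC2.image ho))
    set F : Set Γ := {g : Γ | ∃ x ∈ o '' C1 ∪ o '' C2,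
        (linPart ((g : (Matrix (Fin 4) (Fin 4) ℝ)ˣ) : Matrix (Fin 4) (Fin 4) ℝ)).mulVec x +
          transPart ((g : (Matrix (Fin 4) (Fin 4) ℝ)ˣ) : Matrix (Fin 4) (Fin 4) ℝ) ∈
            o '' C1 ∪ o '' C2} with hFdef
    let ι : Γ → G := fun g => ⟨g, hΓG g.2⟩
    let S : Set G := (fun p : (G × G) × G => (p.1.1)⁻¹ * (p.1.2)⁻¹ * p.2) ''
      ((C2 ×ˢ (ι '' F)) ×ˢ C1)
    have hS : IsCompact S := by
      refine IsCompact.image ((hC2.prod (hF.image ι).isCompact).prod hC1) ?_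
      fun_prop
    obtain ⟨M, hM⟩ : ∃ M : ℝ, ∀ g ∈ S, val g 0 0 ≤ M := by
      have hc : Continuous fun g => val g 0 0 := by fun_prop
      obtain ⟨M, hM⟩ := (hS.image hc).bddAbove
      exact ⟨M, fun g hg => hM ⟨g, hg, rfl⟩⟩
    refine IsCompact.of_isClosed_subset ((isCompact_Icc (a := -(2 * M)) (b := 2 * M)).prod
      (hC2.image hq.continuous)) hcl ?_
    rintro ⟨t, y⟩ hy
    have hy' : (rightMulQuot Γ' (aG t) y, y) ∈ K := hy
    obtain ⟨g, hg, hgy⟩ := hK2 ⟨_, hy', rfl⟩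
    obtain ⟨c, hc, hcy⟩ := hK1 ⟨_, hy', rfl⟩
    simp only at hgy hcy
    refine ⟨?_, ⟨g, hg, hgy⟩⟩
    rw [← hgy, hrm, eq_comm, hqeq] at hcy
    set γ : G := c * (g * aG t)⁻¹ with hγ
    have hcγ : c = γ * (g * aG t) := by rw [hγ]; group
    let γ₀ : Γ := ⟨γ, hcy⟩
    have hγF : γ₀ ∈ F := by
      refine ⟨o g, Or.inr ⟨g, hg, rfl⟩, Or.inl ⟨c, hc, ?_⟩⟩
      change o c = actM (val γ) (o g)
      rw [hcγ, ← hoa g t]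
      exact hact _ _ _
    have haS : aG t ∈ S := by
      refine ⟨((g, γ), c), ⟨⟨hg, γ₀, hγF, rfl⟩, hc⟩, ?_⟩
      simp only
      rw [hcγ]; group
    have h1 := hM _ haS
    rw [haG'] at h1
    have h2 : blockAff (aMat t) 0 0 0 = Real.cosh t := by simp [blockAff, aMat]
    rw [h2, Real.cosh_eq] at h1
    have e1 := Real.add_one_le_exp t
    have e2 := Real.add_one_le_exp (-t)
    have e3 := Real.exp_pos t
    have e4 := Real.exp_pos (-t)
    constructor <;> simp only <;> linarith
  · intro hprop K hK
    have cartan : ∀ g : G, actM (val g) 0 = 0 → ∃ θ ∈ Set.Icc (-Real.pi) Real.pi, ∃ t : ℝ,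
        ∃ φ ∈ Set.Icc (-Real.pi) Real.pi, g = rG θ * aG t * rG φ := by
      intro g hg
      obtain ⟨M, u, hM, hgM⟩ := hGr g
      rw [hgM, actM_blockAff] at hg
      simp at hg
      subst hg
      obtain ⟨θ, hθ, t, ht⟩ := cartan_pt M hM
      have k1 : actM (val g) e3 = actM (val (rG θ * aG t)) e3 := by
        rw [hact, hgM, hrG, haG']; simp only [actM_blockAff, ht]; simp
      have k0 : actM (val g) 0 = actM (val (rG θ * aG t)) 0 := by
        rw [hact, hgM, hrG, haG']; simp only [actM_blockAff]; simp
      set h := (rG θ * aG t)⁻¹ * g with hh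
      have k1' : actM (val h) e3 = e3 := by rw [hh, hact, k1, hactinv]
      have k0' : actM (val h) 0 = 0 := by rw [hh, hact, k0, hactinv]
      obtain ⟨N, v, hN, hhN⟩ := hGr h
      rw [hhN, actM_blockAff] at k0' k1'
      simp at k0'
      subst k0'
      obtain ⟨φ, hφ, hNφ⟩ := stab_rot N hN (by simpa using k1')
      refine ⟨θ, hθ, t, φ, hφ, ?_⟩
      have : h = rG φ := by
        apply hval.injective
        rw [hhN, hrG, hNφ]
      rw [← this, hh]; group
    let I := Set.Icc (-Real.pi) Real.pi
    have hI : IsCompact I := isCompact_Icc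
    let C1 : Set G := (fun p : (Fin 3 → ℝ) × ℝ => τ p.1 * (rG p.2)⁻¹) '' (K ×ˢ I)
    let C2 : Set G := (fun p : (Fin 3 → ℝ) × ℝ => τ p.1 * rG p.2) '' (K ×ˢ I)
    have hC1 : IsCompact C1 := (hK.prod hI).image (by fun_prop)
    have hC2 : IsCompact C2 := (hK.prod hI).image (by fun_prop)
    have hT := (hprop _ ((hC1.image hq.continuous).prod (hC2.image hq.continuous))).image
      continuous_fst
    set T := Prod.fst '' ((fun p : ℝ × Quotient (QuotientGroup.rightRel Γ') =>
          (rightMulQuot Γ' (aG p.1) p.2, p.2)) ⁻¹' ((q '' C1) ×ˢ (q '' C2))) with hTdef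
    let S : Set G := (fun p : (G × ℝ) × G => p.1.1 * aG p.1.2 * (p.2)⁻¹) '' ((C2 ×ˢ T) ×ˢ C1)
    have hS : IsCompact S := ((hC2.prod hT).prod hC1).image (by fun_prop)
    let j : Γ → Γ' := fun g => ⟨⟨g, hΓG g.2⟩, g.2⟩
    have hj : Function.Injective j := by
      intro a b hab
      exact Subtype.ext (congrArg (fun z : Γ' => ((z : G) : (Matrix (Fin 4) (Fin 4) ℝ)ˣ)) hab)
    refine ((hfin S hS).preimage hj.injOn).subset ?_
    rintro g ⟨x, hx, hgx⟩
    let g' : G := ⟨g, hΓG g.2⟩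
    have hτ0 : ∀ y, actM (val (τ y)) 0 = y := by
      intro y; rw [hτ, actM_blockAff]; simp
    set y := actM (val g') x with hy
    have hyK : y ∈ K := hgx
    obtain ⟨θ, hθ, t, φ, hφ, he⟩ := cartan ((τ y)⁻¹ * (g' * τ x)) (by
      rw [hact, hact, hτ0, ← hy]
      conv_lhs => rw [← hτ0 y]
      simp only [hτ0]
      conv_lhs => arg 2; rw [← hτ0 y]
      exact hactinv _ _)
    have hc1 : τ x * (rG φ)⁻¹ ∈ C1 := ⟨(x, φ), ⟨hx, hφ⟩, rfl⟩
    have hc2 : τ y * rG θ ∈ C2 := ⟨(y, θ), ⟨hyK, hθ⟩, rfl⟩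
    have hge : g' = τ y * rG θ * aG t * (τ x * (rG φ)⁻¹)⁻¹ := by
      have : g' = τ y * ((τ y)⁻¹ * (g' * τ x)) * (τ x)⁻¹ := by group
      rw [this, he]; group
    change g' ∈ S
    refine ⟨((τ y * rG θ, t), τ x * (rG φ)⁻¹), ⟨⟨hc2, ?_⟩, hc1⟩, hge.symm⟩
    refine ⟨(t, q (τ y * rG θ)), ⟨⟨_, hc1, ?_⟩, ⟨_, hc2, rfl⟩⟩, rfl⟩
    simp only [hrm]
    rw [hqeq]
    have : τ y * rG θ * aG t * (τ x * (rG φ)⁻¹)⁻¹ ∈ Γ' := by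
      rw [← hge]; exact g.2
    exact this

end
end

section
/- Let γ ∈ SO(2,1)⁰ be hyperbolic, let u ∈ ℝ³, and let g : ℝ³ → ℝ³ be the affine map g(x) = γx + u. Then g has a fixed point in ℝ³ if and only if B(u, x⁰(γ)) = 0. -/
open Matrix

noncomputable section

/-- A matrix is hyperbolic if it has an eigenvalue `λ > 1`. -/
def IsHyperbolic (γ : Matrix (Fin 3) (Fin 3) ℝ) : Prop :=
  ∃ lam : ℝ, 1 < lam ∧ ∃ v : Fin 3 → ℝ, v ≠ 0 ∧ γ.mulVec v = lam • v

/-- `x0` is the neutral vector of `γ`: fixed by `γ`, of unit `B`-norm, and such that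
`det(x₋, x⁰, x₊) > 0` for (any) future-pointing eigenvectors `x₋, x₊` of `γ` for the
eigenvalues `λ > 1` and `λ⁻¹`. -/
def IsNeutral (γ : Matrix (Fin 3) (Fin 3) ℝ) (x0 : Fin 3 → ℝ) : Prop :=
  γ.mulVec x0 = x0 ∧ Bform x0 x0 = 1 ∧
  (∀ (lam : ℝ) (xm xp : Fin 3 → ℝ), 1 < lam → xm ≠ 0 → xp ≠ 0 →
    γ.mulVec xm = lam • xm → γ.mulVec xp = lam⁻¹ • xp →
    0 < xm 2 → 0 < xp 2 → 0 < (Matrix.of ![xm, x0, xp]).det)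

lemma aux_zero (v x z : Fin 3 → ℝ) (hv : v ≠ 0) (hvv : Bform v v = 0)
    (hvx : Bform v x = 0) (hxx : Bform x x = 1) (hzx : Bform z x = 0) (hvz : Bform v z = 0) :
    v 2 ≠ 0 ∧ z = (z 2 / v 2) • v := by
  unfold Bform at *
  have h2 : v 2 ≠ 0 := by
    intro h
    apply hv
    have h0 : v 0 = 0 := by rw [h] at hvv; nlinarith [sq_nonneg (v 0), sq_nonneg (v 1)]
    have h1 : v 1 = 0 := by rw [h] at hvv; nlinarith [sq_nonneg (v 0), sq_nonneg (v 1)]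
    ext i; fin_cases i <;> simp [h, h0, h1]
  refine ⟨h2, ?_⟩
  have hD : v 0 * x 1 - v 1 * x 0 ≠ 0 := by
    intro hD
    have h3 : v 2 ^ 2 * (x 0 ^ 2 + x 1 ^ 2 - x 2 ^ 2) = 0 := by
      linear_combination (v 0 * x 1 - v 1 * x 0) * hD
        - (x 0 ^ 2 + x 1 ^ 2) * hvv + (v 0 * x 0 + v 1 * x 1 + v 2 * x 2) * hvx
    have h4 : x 0 ^ 2 + x 1 ^ 2 - x 2 ^ 2 = 1 := by linear_combination hxx
    rw [h4] at h3
    exact h2 (by simpa using h3)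
  have e0 : v 2 * z 0 = z 2 * v 0 := by
    apply mul_left_cancel₀ hD
    linear_combination x 1 * v 2 * hvz - v 1 * v 2 * hzx - z 2 * x 1 * hvv + z 2 * v 1 * hvx
  have e1 : v 2 * z 1 = z 2 * v 1 := by
    apply mul_left_cancel₀ hD
    linear_combination - x 0 * v 2 * hvz + v 0 * v 2 * hzx + z 2 * x 0 * hvv - z 2 * v 0 * hvx
  ext i
  fin_cases i
  · simp; field_simp; linarith
  · simp; field_simp; linarith
  · simp; field_simp

/-- the affine map `g(x) = γx + u`, with `γ ∈ SO(2,1)⁰` hyperbolic,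
has a fixed point iff `B(u, x⁰(γ)) = 0`. -/
theorem stmt_7 (γ : Matrix (Fin 3) (Fin 3) ℝ) (hγ : SO21 γ) (hhyp : IsHyperbolic γ)
    (u : Fin 3 → ℝ) (x0 : Fin 3 → ℝ) (hx0 : IsNeutral γ x0) :
    (∃ x : Fin 3 → ℝ, γ.mulVec x + u = x) ↔ Bform u x0 = 0 := by
  obtain ⟨hB, -, -⟩ := hγ
  obtain ⟨hfix, hxx, -⟩ := hx0
  obtain ⟨lam, hlam, v, hv, hgv⟩ := hhyp
  have key : ∀ x, Bform (γ.mulVec x) x0 = Bform x x0 := by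
    intro x
    have := hB x x0
    rwa [hfix] at this
  have smulL : ∀ (c : ℝ) (a b : Fin 3 → ℝ), Bform (c • a) b = c * Bform a b := by
    intro c a b; simp [Bform]; ring
  have smulR : ∀ (c : ℝ) (a b : Fin 3 → ℝ), Bform a (c • b) = c * Bform a b := by
    intro c a b; simp [Bform]; ring
  have addL : ∀ (a a' b : Fin 3 → ℝ), Bform (a + a') b = Bform a b + Bform a' b := by
    intro a a' b; simp [Bform]; ring
  have subL : ∀ (a a' b : Fin 3 → ℝ), Bform (a - a') b = Bform a b - Bform a' b := by
    intro a a' b; simp [Bform]; ring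
  constructor
  · rintro ⟨x, hx⟩
    have h := addL (γ.mulVec x) u x0
    rw [hx, key] at h
    linarith
  · intro hu
    have hvx : Bform v x0 = 0 := by
      have := key v
      rw [hgv, smulL] at this
      have h : (lam - 1) * Bform v x0 = 0 := by linarith
      exact (mul_eq_zero.mp h).resolve_left (by linarith)
    have hvv : Bform v v = 0 := by
      have := hB v v
      rw [hgv, smulL, smulR] at this
      have h : (lam * lam - 1) * Bform v v = 0 := by linarith
      exact (mul_eq_zero.mp h).resolve_left (by nlinarith)
    let f : (Fin 3 → ℝ) →ₗ[ℝ] (Fin 3 → ℝ) :=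
      { toFun := fun x => x - γ.mulVec x + Bform x x0 • x0
        map_add' := by
          intro a b
          rw [Matrix.mulVec_add, addL, add_smul]; abel
        map_smul' := by
          intro c a
          rw [Matrix.mulVec_smul, smulL, RingHom.id_apply, smul_add, smul_sub, mul_smul] }
    have hfx : ∀ x, f x = x - γ.mulVec x + Bform x x0 • x0 := fun _ => rfl
    have hfB : ∀ x, Bform (f x) x0 = Bform x x0 := by
      intro x
      rw [hfx, addL, subL, smulL, key, hxx]; ring
    have hinj : Function.Injective f := by
      rw [injective_iff_map_eq_zero]
      intro z hz
      have hzx : Bform z x0 = 0 := by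
        rw [← hfB, hz]; simp [Bform]
      have hgz : γ.mulVec z = z := by
        rw [hfx, hzx, zero_smul, add_zero] at hz
        exact (sub_eq_zero.mp hz).symm
      have hvz : Bform v z = 0 := by
        have := hB v z
        rw [hgv, hgz, smulL] at this
        have h : (lam - 1) * Bform v z = 0 := by linarith
        exact (mul_eq_zero.mp h).resolve_left (by linarith)
      obtain ⟨h2, hzv⟩ := aux_zero v x0 z hv hvv hvx hxx hzx hvz
      have h3 : γ.mulVec z = lam • z := by
        rw [hzv, Matrix.mulVec_smul, hgv, smul_comm]
      rw [hgz] at h3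
      have h4 : (lam - 1) • z = 0 := by rw [sub_smul, one_smul, ← h3, sub_self]
      exact (smul_eq_zero.mp h4).resolve_left (by linarith)
    obtain ⟨x, hx⟩ := (LinearMap.injective_iff_surjective.mp hinj) u
    refine ⟨x, ?_⟩
    have h0 : Bform x x0 = 0 := by rw [← hfB, hx, hu]
    rw [hfx, h0, zero_smul, add_zero] at hx
    rw [← hx]; abel

end
end

section
/- Let Γ₀ ≤ SO(2,1)⁰ be a Schottky group and let u : Γ₀ → ℝ³ be a cocycle. If there exist γ₁, γ₂ ∈ Γ₀ with α_u(γ₁) < 0 < α_u(γ₂), then the affine action of Γ₀ on ℝ³ given by γ·x = γx + u(γ) is not properly discontinuous. -/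
open Matrix

noncomputable section

/-- The underlying matrix of an element of a subgroup of `GL(3,ℝ)`. -/
def toM {Γ₀ : Subgroup (Matrix (Fin 3) (Fin 3) ℝ)ˣ} (γ : Γ₀) : Matrix (Fin 3) (Fin 3) ℝ :=
  ((γ : (Matrix (Fin 3) (Fin 3) ℝ)ˣ) : Matrix (Fin 3) (Fin 3) ℝ)

/-- A Schottky group: a nonabelian discrete subgroup of `SO(2,1)⁰` all of whose
nontrivial elements are hyperbolic. -/
def IsSchottky (Γ₀ : Subgroup (Matrix (Fin 3) (Fin 3) ℝ)ˣ) : Prop :=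
  (∀ γ : Γ₀, SO21 (toM γ)) ∧
  DiscreteTopology Γ₀ ∧
  (∃ a b : Γ₀, a * b ≠ b * a) ∧
  (∀ γ : Γ₀, γ ≠ 1 → IsHyperbolic (toM γ))

/-- A cocycle `u : Γ₀ → ℝ³`, i.e. `u(γ₁γ₂) = u(γ₁) + γ₁ u(γ₂)`. -/
def IsCocycle (Γ₀ : Subgroup (Matrix (Fin 3) (Fin 3) ℝ)ˣ) (u : Γ₀ → Fin 3 → ℝ) : Prop :=
  ∀ γ₁ γ₂ : Γ₀, u (γ₁ * γ₂) = u γ₁ + (toM γ₁).mulVec (u γ₂)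

/-- The affine deformation `γ·x = γx + u(γ)` acts properly discontinuously on `ℝ³`. -/
def ProperlyDisc (Γ₀ : Subgroup (Matrix (Fin 3) (Fin 3) ℝ)ˣ) (u : Γ₀ → Fin 3 → ℝ) : Prop :=
  ∀ K : Set (Fin 3 → ℝ), IsCompact K →
    {γ : Γ₀ | ∃ x ∈ K, (toM γ).mulVec x + u γ ∈ K}.Finite



structure HData {Γ₀ : Subgroup (Matrix (Fin 3) (Fin 3) ℝ)ˣ} (u : Γ₀ → Fin 3 → ℝ) (γ : Γ₀)
    (l a : ℝ) (xm x0 xp o : Fin 3 → ℝ) : Prop where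
  hl : 1 < l
  em : (toM γ).mulVec xm = l • xm
  ep : (toM γ).mulVec xp = l⁻¹ • xp
  e0 : (toM γ).mulVec x0 = x0
  inv : ∀ v w : Fin 3 → ℝ, Bform ((toM γ).mulVec v) ((toM γ).mulVec w) = Bform v w
  nm : Bform xm xm = 0
  np : Bform xp xp = 0
  m0 : Bform xm x0 = 0
  p0 : Bform xp x0 = 0
  n0 : Bform x0 x0 = 1
  fm : 0 < xm 2
  fp : 0 < xp 2
  dt : 0 < (Matrix.of ![xm, x0, xp]).det
  ho : (toM γ).mulVec o + u γ = o + a • x0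

lemma B_smul_left (c : ℝ) (v w : Fin 3 → ℝ) : Bform (c • v) w = c * Bform v w := by
  simp [Bform]; ring
lemma B_smul_right (c : ℝ) (v w : Fin 3 → ℝ) : Bform v (c • w) = c * Bform v w := by
  simp [Bform]; ring
lemma B_add_left (x v w : Fin 3 → ℝ) : Bform (x + v) w = Bform x w + Bform v w := by
  simp [Bform]; ring
lemma B_add_right (x v w : Fin 3 → ℝ) : Bform w (x + v) = Bform w x + Bform w v := by
  simp [Bform]; ring
lemma B_comm (v w : Fin 3 → ℝ) : Bform v w = Bform w v := by
  simp [Bform]; ring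

lemma span3 (a b c : Fin 3 → ℝ) (h : (Matrix.of ![a, b, c]).det ≠ 0) (x : Fin 3 → ℝ) :
    ∃ p q r : ℝ, x = p • a + q • b + r • c := by
  set M := Matrix.of ![a, b, c] with hM
  have hx : Matrix.vecMul (Matrix.vecMul x M⁻¹) M = x := by
    rw [Matrix.vecMul_vecMul, Matrix.nonsing_inv_mul _ (isUnit_iff_ne_zero.mpr h), Matrix.vecMul_one]
  set y := Matrix.vecMul x M⁻¹
  refine ⟨y 0, y 1, y 2, ?_⟩
  rw [← hx]
  ext i
  simp [Matrix.vecMul, dotProduct, Fin.sum_univ_three, hM]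

lemma det_smulc (a b c : Fin 3 → ℝ) (p q r : ℝ) :
    (Matrix.of ![a, b, p • a + q • b + r • c]).det = r * (Matrix.of ![a, b, c]).det := by
  simp [Matrix.det_fin_three]; ring

lemma null_neg (r s : Fin 3 → ℝ) (hr : Bform r r = 0) (hs : Bform s s = 0)
    (fr : 0 < r 2) (fs : 0 < s 2) :
    Bform r s < 0 ∨ s 2 • r = r 2 • s := by
  have key : (r 2 * s 0 - s 2 * r 0)^2 + (r 2 * s 1 - s 2 * r 1)^2
      = -2 * (r 2 * s 2) * Bform r s := by
    simp only [Bform] at *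
    linear_combination (r 2)^2 * hs + (s 2)^2 * hr
  have hp : 0 < r 2 * s 2 := mul_pos fr fs
  by_cases h : Bform r s < 0
  · exact Or.inl h
  · right
    have h0 : (r 2 * s 0 - s 2 * r 0)^2 + (r 2 * s 1 - s 2 * r 1)^2 ≤ 0 := by
      rw [key]; nlinarith [mul_nonneg hp.le (not_lt.mp h)]
    have h1 : r 2 * s 0 - s 2 * r 0 = 0 := by
      apply pow_eq_zero_iff (two_ne_zero) |>.mp
      nlinarith [sq_nonneg (r 2 * s 0 - s 2 * r 0), sq_nonneg (r 2 * s 1 - s 2 * r 1)]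
    have h2 : r 2 * s 1 - s 2 * r 1 = 0 := by
      apply pow_eq_zero_iff (two_ne_zero) |>.mp
      nlinarith [sq_nonneg (r 2 * s 0 - s 2 * r 0), sq_nonneg (r 2 * s 1 - s 2 * r 1)]
    ext i; fin_cases i <;> simp <;> linarith

/-- positivity of the determinant does not depend on the third vector -/
lemma det_pos_of (r x p s : Fin 3 → ℝ) (hrr : Bform r r = 0) (hrx : Bform r x = 0)
    (hrp : Bform r p < 0) (hrs : Bform r s < 0) (hd : 0 < (Matrix.of ![r, x, p]).det) :
    0 < (Matrix.of ![r, x, s]).det := by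
  obtain ⟨a, b, c, rfl⟩ := span3 r x p hd.ne' s
  rw [det_smulc]
  simp only [B_add_right, B_smul_right, hrr, hrx, mul_zero, zero_add] at hrs
  have : 0 < c := by nlinarith
  positivity

lemma det_rev (a b c : Fin 3 → ℝ) :
    (Matrix.of ![c, -b, a]).det = (Matrix.of ![a, b, c]).det := by
  simp [Matrix.det_fin_three]; ring

lemma exists_data {Γ₀ : Subgroup (Matrix (Fin 3) (Fin 3) ℝ)ˣ} (u : Γ₀ → Fin 3 → ℝ) (γ : Γ₀)
    (hso : SO21 (toM γ)) (hh : IsHyperbolic (toM γ)) (x0 : Fin 3 → ℝ)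
    (hn : IsNeutral (toM γ) x0) :
    ∃ l xm xp o, HData u γ l (Bform (u γ) x0) xm x0 xp o := by
  obtain ⟨inv, hdet, -⟩ := hso
  obtain ⟨l, hl, v, hv, ev⟩ := hh
  obtain ⟨e0, n0, hpos⟩ := hn
  set g := toM γ with hg
  have hl0 : 0 < l := by linarith
  have null_aux : ∀ (c : ℝ) (w : Fin 3 → ℝ), w ≠ 0 → g.mulVec w = c • w → c^2 ≠ 1 →
      ∃ w' : Fin 3 → ℝ, w' ≠ 0 ∧ g.mulVec w' = c • w' ∧ Bform w' w' = 0 ∧ Bform w' x0 = 0 ∧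
        0 < w' 2 := by
    intro c w hw ew hc
    have h1 : Bform w w = 0 := by
      have := inv w w
      rw [ew, B_smul_left, B_smul_right] at this
      have h2 : (c^2 - 1) * Bform w w = 0 := by linear_combination this
      exact (mul_eq_zero.mp h2).resolve_left (sub_ne_zero.mpr hc)
    have h2 : Bform w x0 = 0 := by
      have := inv w x0
      rw [ew, B_smul_left, e0] at this
      have h2 : (c - 1) * Bform w x0 = 0 := by linear_combination this
      refine (mul_eq_zero.mp h2).resolve_left (sub_ne_zero.mpr ?_)
      rintro rfl; simp at hc
    have h3 : w 2 ≠ 0 := by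
      intro h
      apply hw
      simp only [Bform, h] at h1
      have a0 : w 0 = 0 := by nlinarith [sq_nonneg (w 0), sq_nonneg (w 1)]
      have a1 : w 1 = 0 := by nlinarith [sq_nonneg (w 0), sq_nonneg (w 1)]
      ext i; fin_cases i <;> simp [h, a0, a1]
    rcases lt_or_gt_of_ne h3 with h | h
    · refine ⟨-w, neg_ne_zero.mpr hw, ?_, ?_, ?_, ?_⟩
      · rw [Matrix.mulVec_neg, ew, smul_neg]
      · simpa [Bform] using h1
      · simp only [Bform, Pi.neg_apply] at *; linarith
      · simpa using h
    · exact ⟨w, hw, ew, h1, h2, h⟩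
  -- eigenvector for the inverse
  have hy : ∃ y : Fin 3 → ℝ, y ≠ 0 ∧ g.mulVec y = l⁻¹ • y := by
    have hd : (g - l • (1 : Matrix (Fin 3) (Fin 3) ℝ)).det = 0 := by
      apply Matrix.exists_mulVec_eq_zero_iff.mp
      exact ⟨v, hv, by rw [Matrix.sub_mulVec, ev, Matrix.smul_mulVec, Matrix.one_mulVec, sub_self]⟩
    obtain ⟨z, hz, ez⟩ := Matrix.exists_vecMul_eq_zero_iff.mpr hd
    rw [Matrix.vecMul_sub, Matrix.vecMul_smul, Matrix.vecMul_one, sub_eq_zero] at ez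
    have hB : ∀ t, Bform ![z 0, z 1, -z 2] t = z ⬝ᵥ t := by
      intro t; simp [Bform, dotProduct, Fin.sum_univ_three]
    set y : Fin 3 → ℝ := ![z 0, z 1, -z 2] with hyd
    have hy0 : y ≠ 0 := by
      intro h
      apply hz
      have a0 := congrFun h 0
      have a1 := congrFun h 1
      have a2 := congrFun h 2
      simp [hyd] at a0 a1 a2
      ext i; fin_cases i <;> simp [a0, a1, a2]
    refine ⟨y, hy0, ?_⟩
    have hgt : ∀ t, Bform y (g.mulVec t) = l * Bform y t := by
      intro t
      rw [hB, hB, Matrix.dotProduct_mulVec, ez, smul_dotProduct, smul_eq_mul]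
    have hall : ∀ t, Bform (g.mulVec y - l⁻¹ • y) t = 0 := by
      intro t
      have ht : g.mulVec (g⁻¹.mulVec t) = t := by
        rw [Matrix.mulVec_mulVec, Matrix.mul_nonsing_inv _ (by rw [hdet]; exact isUnit_one),
          Matrix.one_mulVec]
      set t' := g⁻¹.mulVec t
      rw [← ht, sub_eq_add_neg, ← neg_smul, B_add_left, B_smul_left, inv, hgt]
      field_simp; ring
    rw [← sub_eq_zero]
    ext i
    fin_cases i
    · simpa [Bform] using hall ![1, 0, 0]
    · simpa [Bform] using hall ![0, 1, 0]
    · have := hall ![0, 0, 1]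
      simp [Bform] at this ⊢
      linarith
  obtain ⟨y, hy0, ey⟩ := hy
  have hl2 : l^2 ≠ 1 := by nlinarith
  have hli2 : (l⁻¹)^2 ≠ 1 := by rw [inv_pow]; intro h; exact hl2 (inv_eq_one.mp h)
  obtain ⟨xm, xm0, em, nm, m0, fm⟩ := null_aux l v hv ev hl2
  obtain ⟨xp, xp0, ep, np, p0, fp⟩ := null_aux l⁻¹ y hy0 ey hli2
  have dt := hpos l xm xp hl xm0 xp0 em ep fm fp
  obtain ⟨a, b, c, hu⟩ := span3 xm x0 xp dt.ne' (u γ)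
  have hb : Bform (u γ) x0 = b := by
    rw [hu]; simp [B_add_left, B_smul_left, m0, p0, n0]
  refine ⟨l, xm, xp, (a / (1 - l)) • xm + (c / (1 - l⁻¹)) • xp,
    hl, em, ep, e0, inv, nm, np, m0, p0, n0, fm, fp, dt, ?_⟩
  rw [hb, hu, ← hg, Matrix.mulVec_add, Matrix.mulVec_smul, Matrix.mulVec_smul, em, ep]
  have d1 : 1 - l ≠ 0 := by linarith
  have d2 : 1 - l⁻¹ ≠ 0 := by
    have : l⁻¹ < 1 := inv_lt_one_of_one_lt₀ hl
    linarith
  have i1 : a / (1 - l) * (1 - l) = a := div_mul_cancel₀ _ d1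
  have i2 : c / (1 - l⁻¹) * (1 - l⁻¹) = c := div_mul_cancel₀ _ d2
  ext i
  simp only [Pi.add_apply, Pi.smul_apply, smul_eq_mul]
  linear_combination (-xm i) * i1 - (xp i) * i2

section
variable {Γ₀ : Subgroup (Matrix (Fin 3) (Fin 3) ℝ)ˣ} {u : Γ₀ → Fin 3 → ℝ}

lemma toM_mul (a b : Γ₀) : toM (a * b) = toM a * toM b := by simp [toM]
lemma toM_one : toM (1 : Γ₀) = 1 := by simp [toM]

lemma u_one (hu : IsCocycle Γ₀ u) : u 1 = 0 := by
  have := hu 1 1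
  rw [toM_one, Matrix.one_mulVec, mul_one] at this
  simpa using this

lemma act_mul (hu : IsCocycle Γ₀ u) (a b : Γ₀) (x : Fin 3 → ℝ) :
    (toM (a * b)).mulVec x + u (a * b) = (toM a).mulVec ((toM b).mulVec x + u b) + u a := by
  rw [hu, toM_mul, Matrix.mulVec_add, Matrix.mulVec_mulVec]; abel

lemma inv_mulVec (γ : Γ₀) (x y : Fin 3 → ℝ) (h : (toM γ).mulVec x = y) :
    (toM γ⁻¹).mulVec y = x := by
  rw [← h, Matrix.mulVec_mulVec, ← toM_mul, inv_mul_cancel, toM_one, Matrix.one_mulVec]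

lemma HData.symm (hu : IsCocycle Γ₀ u) {γ : Γ₀} {l a : ℝ} {xm x0 xp o : Fin 3 → ℝ}
    (h : HData u γ l a xm x0 xp o) : HData u γ⁻¹ l a xp (-x0) xm o := by
  have hl0 : l ≠ 0 := by have := h.hl; linarith
  have e0 := inv_mulVec γ _ _ h.e0
  refine ⟨h.hl, ?_, ?_, ?_, ?_, h.np, h.nm, ?_, ?_, ?_, h.fp, h.fm, ?_, ?_⟩
  · have := inv_mulVec γ _ _ h.ep
    rw [Matrix.mulVec_smul] at this
    nth_rewrite 2 [← this]
    rw [smul_smul, mul_inv_cancel₀ hl0, one_smul]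
  · have := inv_mulVec γ _ _ h.em
    rw [Matrix.mulVec_smul] at this
    nth_rewrite 2 [← this]
    rw [smul_smul, inv_mul_cancel₀ hl0, one_smul]
  · rw [Matrix.mulVec_neg, e0]
  · intro v w
    rw [← h.inv]
    simp only [Matrix.mulVec_mulVec, ← toM_mul, mul_inv_cancel, toM_one, Matrix.one_mulVec]
  · have := h.p0; simp only [Bform, Pi.neg_apply] at *; linarith
  · have := h.m0; simp only [Bform, Pi.neg_apply] at *; linarith
  · have := h.n0; simp only [Bform, Pi.neg_apply] at *; linarith
  · rw [det_rev]; exact h.dt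
  · have h1 := act_mul hu γ⁻¹ γ o
    rw [inv_mul_cancel, toM_one, Matrix.one_mulVec, u_one hu, h.ho, Matrix.mulVec_add,
      Matrix.mulVec_smul, e0] at h1
    ext i
    have := congrFun h1 i
    simp at this ⊢
    linarith

lemma HData.iter (hu : IsCocycle Γ₀ u) {γ : Γ₀} {l a : ℝ} {xm x0 xp o : Fin 3 → ℝ}
    (h : HData u γ l a xm x0 xp o) (n : ℕ) (p q r : ℝ) :
    (toM (γ ^ n)).mulVec (o + p • xm + q • x0 + r • xp) + u (γ ^ n)
      = o + (l ^ n * p) • xm + (q + n * a) • x0 + ((l⁻¹) ^ n * r) • xp := by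
  induction n with
  | zero => simp [toM_one, u_one hu]
  | succ n ih =>
    rw [pow_succ', act_mul hu, ih]
    simp only [Matrix.mulVec_add, Matrix.mulVec_smul, h.em, h.e0, h.ep]
    ext i
    have := congrFun h.ho i
    simp only [Pi.add_apply, Pi.smul_apply, smul_eq_mul] at this ⊢
    push_cast
    linear_combination this

lemma HData.pow_m {γ : Γ₀} {l a : ℝ} {xm x0 xp o : Fin 3 → ℝ}
    (h : HData u γ l a xm x0 xp o) (n : ℕ) : (toM (γ ^ n)).mulVec xm = l ^ n • xm := by
  induction n with
  | zero => simp [toM_one]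
  | succ n ih =>
    rw [pow_succ', toM_mul, ← Matrix.mulVec_mulVec, ih, Matrix.mulVec_smul, h.em, smul_smul,
      pow_succ]

lemma HData.pow_p {γ : Γ₀} {l a : ℝ} {xm x0 xp o : Fin 3 → ℝ}
    (h : HData u γ l a xm x0 xp o) (n : ℕ) : (toM (γ ^ n)).mulVec xp = (l⁻¹) ^ n • xp := by
  induction n with
  | zero => simp [toM_one]
  | succ n ih =>
    rw [pow_succ', toM_mul, ← Matrix.mulVec_mulVec, ih, Matrix.mulVec_smul, h.ep, smul_smul,
      pow_succ]

lemma HData.pow_inv {γ : Γ₀} {l a : ℝ} {xm x0 xp o : Fin 3 → ℝ}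
    (h : HData u γ l a xm x0 xp o) (n : ℕ) (v w : Fin 3 → ℝ) :
    Bform ((toM (γ ^ n)).mulVec v) ((toM (γ ^ n)).mulVec w) = Bform v w := by
  induction n with
  | zero => simp [toM_one]
  | succ n ih =>
    rw [pow_succ', toM_mul, ← Matrix.mulVec_mulVec, ← Matrix.mulVec_mulVec, h.inv, ih]

lemma bdd_aux (l : ℝ) (hl : 1 < l) : ∃ M : ℝ, 0 ≤ M ∧ ∀ n : ℕ, (n : ℝ) * (l⁻¹) ^ n ≤ M := by
  have := tendsto_self_mul_const_pow_of_lt_one (r := l⁻¹) (by positivity)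
    (inv_lt_one_of_one_lt₀ hl)
  obtain ⟨M, hM⟩ := this.bddAbove_range
  refine ⟨max M 0, le_max_right _ _, fun n => le_trans (hM ⟨n, rfl⟩) (le_max_left _ _)⟩

/-- boundedness of `l⁻ⁿ (A + (c + n d) k)` -/
lemma bdd_aux2 (l M A k d c D : ℝ) (hl : 1 < l) (hM : ∀ n : ℕ, (n : ℝ) * (l⁻¹) ^ n ≤ M)
    (n : ℕ) (hc : |c| ≤ D) :
    |(l⁻¹) ^ n * (A + (c + n * d) * k)| ≤ |A| + D * |k| + M * |d| * |k| := by
  have hp : 0 ≤ (l⁻¹) ^ n := by positivity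
  have hp1 : (l⁻¹) ^ n ≤ 1 := pow_le_one₀ (by positivity) (inv_le_one_of_one_le₀ hl.le)
  have e : (l⁻¹) ^ n * (A + (c + n * d) * k)
    = (l⁻¹) ^ n * (A + c * k) + (n * (l⁻¹) ^ n) * (d * k) := by ring
  rw [e]
  refine (abs_add_le _ _).trans ?_
  have b1 : |(l⁻¹) ^ n * (A + c * k)| ≤ |A| + D * |k| := by
    rw [abs_mul, abs_of_nonneg hp]
    have : |A + c * k| ≤ |A| + D * |k| := by
      refine (abs_add_le _ _).trans ?_
      rw [abs_mul]
      gcongr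
    calc _ ≤ 1 * |A + c * k| := by gcongr
      _ ≤ _ := by rw [one_mul]; exact this
  have b2 : |(n * (l⁻¹) ^ n) * (d * k)| ≤ M * |d| * |k| := by
    rw [abs_mul, abs_mul d, abs_of_nonneg (by positivity : 0 ≤ (n : ℝ) * (l⁻¹) ^ n), mul_assoc M]
    exact mul_le_mul_of_nonneg_right (hM n) (by positivity)
  linarith

lemma v_eq (r s v w : Fin 3 → ℝ) (hrr : Bform r r = 0) (hss : Bform s s = 0)
    (hrs : Bform r s < 0)
    (vr : Bform v r = 0) (vs : Bform v s = 0) (vv : Bform v v = 1)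
    (wr : Bform w r = 0) (ws : Bform w s = 0) (ww : Bform w w = 1)
    (dv : 0 < (Matrix.of ![r, v, s]).det) (dw : 0 < (Matrix.of ![r, w, s]).det) : v = w := by
  obtain ⟨a, b, c, rfl⟩ := span3 r v s dv.ne' w
  simp only [B_add_left, B_add_right, B_smul_left, B_smul_right, hrr, hss, vr, vs, vv,
    B_comm s r, B_comm r v, B_comm s v, mul_zero, zero_add, add_zero] at wr ws ww
  have hc : c = 0 := (mul_eq_zero.mp wr).resolve_right hrs.ne
  have ha : a = 0 := (mul_eq_zero.mp ws).resolve_right hrs.ne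
  subst hc ha
  have hd : (Matrix.of ![r, (0:ℝ) • r + b • v + (0:ℝ) • s, s]).det
      = b * (Matrix.of ![r, v, s]).det := by
    simp [Matrix.det_fin_three]; ring
  rw [hd] at dw
  have hb : 0 < b := pos_of_mul_pos_left dw dv.le
  have : b = 1 := by nlinarith
  simp [this]

lemma main_aux (hu : IsCocycle Γ₀ u) {γ₁ γ₂ : Γ₀} {l₁ a₁ l₂ a₂ : ℝ}
    {m₁ z₁ p₁ o₁ m₂ z₂ p₂ o₂ : Fin 3 → ℝ}
    (h1 : HData u γ₁ l₁ a₁ m₁ z₁ p₁ o₁) (h2 : HData u γ₂ l₂ a₂ m₂ z₂ p₂ o₂)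
    (ha1 : a₁ < 0) (ha2 : 0 < a₂) (hrs : Bform m₂ p₁ < 0) : ¬ ProperlyDisc Γ₀ u := by
  intro hPD
  have hmp : ∀ {γ : Γ₀} {l a : ℝ} {xm x0 xp o : Fin 3 → ℝ}, HData u γ l a xm x0 xp o →
      Bform xm xp < 0 := by
    intro γ l a xm x0 xp o h
    rcases null_neg xm xp h.nm h.np h.fm h.fp with h' | h'
    · exact h'
    · exfalso
      have hd := h.dt
      have : xp 2 * (Matrix.of ![xm, x0, xp]).det = 0 := by
        have : xp 2 * (Matrix.of ![xm, x0, xp]).det = (Matrix.of ![xp 2 • xm, x0, xp]).det := by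
          simp [Matrix.det_fin_three]; ring
        rw [this, h']
        simp [Matrix.det_fin_three]; ring
      exact (mul_pos h.fp hd).ne' this
  have d2 : 0 < (Matrix.of ![m₂, z₂, p₁]).det :=
    det_pos_of _ _ _ _ h2.nm h2.m0 (hmp h2) hrs h2.dt
  have d1 : 0 < (Matrix.of ![m₂, z₁, p₁]).det := by
    have h1' := h1.symm hu
    rw [← det_rev]
    exact det_pos_of _ _ _ _ h1'.nm h1'.m0 (hmp h1') (by rw [B_comm]; exact hrs) h1'.dt
  obtain ⟨k, k', hv⟩ : ∃ k k' : ℝ, z₂ + k • m₂ = z₁ + k' • p₁ := by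
    refine ⟨-Bform z₂ p₁ / Bform m₂ p₁, -Bform z₁ m₂ / Bform m₂ p₁, ?_⟩
    have hne := hrs.ne
    have zm2 : Bform z₂ m₂ = 0 := by rw [B_comm]; exact h2.m0
    have zp1 : Bform z₁ p₁ = 0 := by rw [B_comm]; exact h1.p0
    apply v_eq m₂ p₁ _ _ h2.nm h1.np hrs
    · simp [B_add_left, B_smul_left, zm2, h2.nm]
    · simp only [B_add_left, B_smul_left]; field_simp; ring
    · simp [B_add_left, B_smul_left, B_add_right, B_smul_right, zm2, h2.nm, h2.m0, h2.n0]
    · simp only [B_add_left, B_smul_left, B_comm p₁ m₂]; field_simp; ring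
    · simp [B_add_left, B_smul_left, zp1, h1.np]
    · simp [B_add_left, B_smul_left, B_add_right, B_smul_right, zp1, h1.np, h1.p0, h1.n0]
    · generalize -Bform z₂ p₁ / Bform m₂ p₁ = c
      convert d2 using 1
      simp [Matrix.det_fin_three]; ring
    · generalize -Bform z₁ m₂ / Bform m₂ p₁ = c
      convert d1 using 1
      simp [Matrix.det_fin_three]; ring
  obtain ⟨A, β, C, hw⟩ := span3 m₂ z₂ p₁ d2.ne' (o₁ - o₂)
  -- the line
  have line : ∀ t : ℝ, o₂ + (A + t * k) • m₂ + (β + t) • z₂ + (0:ℝ) • p₂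
      = o₁ + (0:ℝ) • m₁ + t • z₁ + (-C + t * k') • p₁ := by
    intro t
    ext i
    have e1 := congrFun hv i
    have e2 := congrFun hw i
    simp at e1 e2 ⊢
    linear_combination t * e1 - e2
  have hl1 := h1.hl
  have hl2 := h2.hl
  obtain ⟨M₁, -, hM₁⟩ := bdd_aux l₁ hl1
  obtain ⟨M₂, -, hM₂⟩ := bdd_aux l₂ hl2
  let N : ℕ → ℕ := fun m => ⌊(m * a₂) / (-a₁)⌋₊
  have hN : ∀ m : ℕ, |m * a₂ + N m * a₁| ≤ -a₁ := by
    intro m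
    have hnn : 0 ≤ (m * a₂) / (-a₁) := div_nonneg (by positivity) (by linarith)
    have f1 := Nat.floor_le hnn
    have f2 := Nat.lt_floor_add_one ((m * a₂) / (-a₁))
    rw [le_div_iff₀ (by linarith)] at f1
    rw [div_lt_iff₀ (by linarith)] at f2
    change (N m : ℝ) * _ ≤ _ at f1
    change _ < ((N m : ℝ) + 1) * _ at f2
    rw [abs_le]; constructor <;> linarith
  have hNmono : Monotone N := by
    intro m m' h
    apply Nat.floor_le_floor
    apply div_le_div_of_nonneg_right _ (by linarith)
    have : (m : ℝ) ≤ m' := by exact_mod_cast h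
    nlinarith
  let F : ℕ → Γ₀ := fun m => γ₁ ^ (N m) * γ₂ ^ m
  have hinj : Function.Injective F := by
    have key : ∀ m m' : ℕ, m < m' → F m ≠ F m' := by
      intro m m' hlt he
      obtain ⟨j, hj⟩ := Nat.exists_eq_add_of_le (hNmono hlt.le)
      simp only [F, hj, pow_add, mul_assoc] at he
      have he := mul_left_cancel he
      have e1 : (toM (γ₂ ^ m)).mulVec m₂ = (toM (γ₁ ^ j * γ₂ ^ m')).mulVec m₂ := by rw [he]
      rw [toM_mul, ← Matrix.mulVec_mulVec, h2.pow_m, h2.pow_m] at e1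
      have e2 := h1.pow_inv j (l₂ ^ m' • m₂) p₁
      rw [← e1, h1.pow_p, B_smul_left, B_smul_left, B_smul_right, ← mul_assoc] at e2
      have e3 := mul_right_cancel₀ hrs.ne e2
      have q1 : (l₁⁻¹) ^ j ≤ 1 := pow_le_one₀ (by positivity) (inv_le_one_of_one_le₀ hl1.le)
      have q2 : l₂ ^ m < l₂ ^ m' := pow_lt_pow_right₀ hl2 hlt
      have q3 : 0 < l₂ ^ m := by positivity
      nlinarith
    intro m m' h
    by_contra hne
    rcases lt_or_gt_of_ne hne with h' | h'
    · exact key _ _ h' h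
    · exact key _ _ h' h.symm
  let D₂ : ℝ := |A| + 0 * |k| + M₂ * |a₂| * |k|
  let D₁ : ℝ := |(-C)| + (-a₁) * |k'| + M₁ * |(-a₁)| * |k'|
  let R : ℝ := max (‖o₂‖ + D₂ * ‖m₂‖ + |β| * ‖z₂‖) (‖o₁‖ + (-a₁) * ‖z₁‖ + D₁ * ‖p₁‖)
  have hfin := hPD (Metric.closedBall 0 R) (isCompact_closedBall 0 R)
  refine Set.infinite_of_injective_forall_mem hinj (fun m => ?_) hfin
  have B2 := bdd_aux2 l₂ M₂ A k a₂ 0 0 hl2 hM₂ m (by simp)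
  have B1 := bdd_aux2 l₁ M₁ (-C) k' (-a₁) (m * a₂ + N m * a₁) (-a₁) hl1 hM₁ (N m) (hN m)
  have hcan : l₂ ^ m * ((l₂⁻¹) ^ m * (A + (0 + m * a₂) * k)) = A + (m * a₂) * k := by
    rw [← mul_assoc, ← mul_pow, mul_inv_cancel₀ (by linarith), one_pow]; ring
  refine ⟨o₂ + ((l₂⁻¹) ^ m * (A + (0 + m * a₂) * k)) • m₂ + β • z₂ + (0:ℝ) • p₂, ?_, ?_⟩
  · rw [mem_closedBall_zero_iff]
    refine le_trans ?_ (le_max_left _ _)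
    rw [zero_smul, add_zero]
    refine (norm_add₃_le).trans ?_
    rw [norm_smul, norm_smul, Real.norm_eq_abs, Real.norm_eq_abs]
    gcongr
  · rw [act_mul hu, h2.iter hu, hcan, mul_zero, line, h1.iter hu, mem_closedBall_zero_iff]
    refine le_trans ?_ (le_max_right _ _)
    rw [mul_zero, zero_smul, add_zero]
    refine (norm_add₃_le).trans ?_
    rw [norm_smul, norm_smul, Real.norm_eq_abs, Real.norm_eq_abs]
    have e : -C + m * a₂ * k' = -C + (m * a₂ + N m * a₁ + N m * (-a₁)) * k' := by ring
    rw [e]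
    gcongr
    exact hN m
end

/-- if the Margulis invariant of a cocycle over a Schottky group takes both
a negative and a positive value, the affine deformation is not properly discontinuous. -/
theorem stmt_12 (Γ₀ : Subgroup (Matrix (Fin 3) (Fin 3) ℝ)ˣ) (hS : IsSchottky Γ₀)
    (u : Γ₀ → Fin 3 → ℝ) (hu : IsCocycle Γ₀ u)
    (γ₁ γ₂ : Γ₀) (h₁ : γ₁ ≠ 1) (h₂ : γ₂ ≠ 1)
    (hneg : ∃ x0 : Fin 3 → ℝ, IsNeutral (toM γ₁) x0 ∧ Bform (u γ₁) x0 < 0)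
    (hpos : ∃ x0 : Fin 3 → ℝ, IsNeutral (toM γ₂) x0 ∧ 0 < Bform (u γ₂) x0) :
    ¬ ProperlyDisc Γ₀ u := by
  obtain ⟨hso, -, -, hhyp⟩ := hS
  obtain ⟨x, hx, hax⟩ := hneg
  obtain ⟨y, hy, hay⟩ := hpos
  obtain ⟨l₁, m₁, p₁, o₁, d1⟩ := exists_data u γ₁ (hso _) (hhyp _ h₁) x hx
  obtain ⟨l₂, m₂, p₂, o₂, d2⟩ := exists_data u γ₂ (hso _) (hhyp _ h₂) y hy
  rcases null_neg m₂ p₁ d2.nm d1.np d2.fm d1.fp with h | h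
  · exact main_aux hu d1 d2 hax hay h
  rcases null_neg m₂ m₁ d2.nm d1.nm d2.fm d1.fm with h' | h'
  · exact main_aux hu (d1.symm hu) d2 hax hay h'
  exfalso
  -- then `m₁` and `p₁` are parallel
  have hd := d1.dt
  have f2 := d2.fm
  have hz : m₂ 2 * m₂ 2 * (Matrix.of ![m₁, x, p₁]).det = 0 := by
    have : m₂ 2 * m₂ 2 * (Matrix.of ![m₁, x, p₁]).det
        = (Matrix.of ![m₂ 2 • m₁, x, m₂ 2 • p₁]).det := by
      simp [Matrix.det_fin_three]; ring
    rw [this, ← h, ← h']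
    simp [Matrix.det_fin_three]; ring
  exact (mul_pos (mul_pos f2 f2) hd).ne' hz

end
end
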